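/- If H is a 4-Ore graph with T(H) = 3 and H' is obtained from H by splitting a vertex v into two vertices v1, v2 (each of positive degree, partitioning the edges incident to v), then either H' contains a diamond in which neither v1 nor v2 is a degree-three vertex of the diamond, or T(H') ≥ 3. -/

import Mathlib

open SimpleGraph

/-- A graph is 4-critical if it is not 3-colorable but every proper subgraph is 3-colorable. -/
def FourCritical {V : Type*} (G : SimpleGraph V) : Prop :=
  ¬ G.Colorable 3 ∧ ∀ H : SimpleGraph V, H < G → H.Colorable 3

/-- `S` is the vertex set of a cycle of length at most four in `G`. -/
def ShortCycleSet {V : Type*} (G : SimpleGraph V) (S : Set V) : Prop :=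
  ∃ (v : V) (w : G.Walk v v), w.IsCycle ∧ w.length ≤ 4 ∧ {x | x ∈ w.support} = S

/-- `maxTri G` (the quantity `T(G)` of the paper) is the maximum number of pairwise
vertex-disjoint cycles of length at most four in `G`. -/
noncomputable def maxTri {V : Type*} (G : SimpleGraph V) : ℕ :=
  sSup {n | ∃ C : Finset (Set V), C.card = n ∧ (∀ S ∈ C, ShortCycleSet G S) ∧
    (C : Set (Set V)).Pairwise Disjoint}

/-- The potential `p(G) = 5|V(G)| - 3|E(G)| - T(G)`. -/
noncomputable def pot {V : Type*} (G : SimpleGraph V) : ℤ :=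
  5 * (Nat.card V : ℤ) - 3 * (Nat.card G.edgeSet : ℤ) - (maxTri G : ℤ)

/-- The graph obtained by the Ore composition of `G₁` (edge side, replaced edge `xy`) and
`G₂` (split side, split vertex `z`, with `A` the set of neighbours of `z` assigned to the
copy `z₁` identified with `x`). -/
def oreGraph {V₁ V₂ : Type*} (G₁ : SimpleGraph V₁) (x y : V₁) (G₂ : SimpleGraph V₂)
    (z : V₂) (A : Set V₂) : SimpleGraph (V₁ ⊕ {v : V₂ // v ≠ z}) :=
  SimpleGraph.fromRel (fun a b =>
    match a, b with
    | Sum.inl a, Sum.inl b => G₁.Adj a b ∧ ¬(a = x ∧ b = y) ∧ ¬(a = y ∧ b = x)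
    | Sum.inr a, Sum.inr b => G₂.Adj a.1 b.1
    | Sum.inl a, Sum.inr b => G₂.Adj z b.1 ∧ ((a = x ∧ b.1 ∈ A) ∨ (a = y ∧ b.1 ∉ A))
    | Sum.inr _, Sum.inl _ => False)

/-- `H` is an Ore composition of `G₁` and `G₂`: an edge `xy` of `G₁` is deleted, a vertex `z`
of `G₂` is split into two vertices of positive degree, which are identified with `x` and `y`. -/
def IsOreComposition {V₁ V₂ V₃ : Type*} (H : SimpleGraph V₃) (G₁ : SimpleGraph V₁)
    (G₂ : SimpleGraph V₂) : Prop :=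
  ∃ (x y : V₁) (z : V₂) (A : Set V₂), G₁.Adj x y ∧
    (A ∩ G₂.neighborSet z).Nonempty ∧ ((G₂.neighborSet z) \ A).Nonempty ∧
    Nonempty (H ≃g oreGraph G₁ x y G₂ z A)

/-- The 4-Ore graphs on vertex sets `Fin n`: obtained from copies of `K₄` by
repeated Ore compositions. -/
inductive FourOreAux : ∀ {n : ℕ}, SimpleGraph (Fin n) → Prop
  | k4 : FourOreAux (⊤ : SimpleGraph (Fin 4))
  | ore {n₁ n₂ n : ℕ} {G₁ : SimpleGraph (Fin n₁)} {G₂ : SimpleGraph (Fin n₂)}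
      {G : SimpleGraph (Fin n)} :
      FourOreAux G₁ → FourOreAux G₂ → IsOreComposition G G₁ G₂ → FourOreAux G

/-- A graph is 4-Ore if it is isomorphic to a 4-Ore graph on some `Fin n`. -/
def IsFourOre {V : Type*} (H : SimpleGraph V) : Prop :=
  ∃ (n : ℕ) (G : SimpleGraph (Fin n)), FourOreAux G ∧ Nonempty (H ≃g G)

/-- `G` contains `K₄` minus an edge as a subgraph (vertices `a,b` of degree three in it). -/
def HasK4MinusE {V : Type*} (G : SimpleGraph V) : Prop :=
  ∃ a b c d : V, a ≠ b ∧ a ≠ c ∧ a ≠ d ∧ b ≠ c ∧ b ≠ d ∧ c ≠ d ∧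
    G.Adj a b ∧ G.Adj a c ∧ G.Adj a d ∧ G.Adj b c ∧ G.Adj b d

/-- `a,b,c,d` form a diamond of `H`: a subgraph isomorphic to `K₄ - e` (with `a,b` its
degree-three vertices) such that `a` and `b` also have degree three in `H`. -/
def IsDiamond {V : Type*} (H : SimpleGraph V) (a b c d : V) : Prop :=
  a ≠ b ∧ a ≠ c ∧ a ≠ d ∧ b ≠ c ∧ b ≠ d ∧ c ≠ d ∧
  H.Adj a b ∧ H.Adj a c ∧ H.Adj a d ∧ H.Adj b c ∧ H.Adj b d ∧
  (H.neighborSet a).ncard = 3 ∧ (H.neighborSet b).ncard = 3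

/-- Splitting the vertex `v` of `G` into two vertices `Sum.inr 0` and `Sum.inr 1`, the
neighbours of `v` in `A` going to the first and the remaining neighbours to the second. -/
def splitGraph {V : Type*} (G : SimpleGraph V) (v : V) (A : Set V) :
    SimpleGraph ({u : V // u ≠ v} ⊕ Fin 2) :=
  SimpleGraph.fromRel (fun a b =>
    match a, b with
    | Sum.inl a, Sum.inl b => G.Adj a.1 b.1
    | Sum.inl a, Sum.inr i => G.Adj v a.1 ∧ ((i = 0 ∧ a.1 ∈ A) ∨ (i = 1 ∧ a.1 ∉ A))
    | _, _ => False)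

/-- The graph `T₈` of the paper. -/
def T8 : SimpleGraph (Fin 8) :=
  SimpleGraph.fromRel (fun a b => (a, b) ∈
    ([(0,1),(1,2),(2,0),(0,3),(3,6),(6,7),(7,3),(2,4),(4,6),(6,5),(5,1),(4,7),(7,5)] :
      List (Fin 8 × Fin 8)))

/-- The graph `T₁₁` of the paper. -/
def T11 : SimpleGraph (Fin 11) :=
  SimpleGraph.fromRel (fun a b => (a, b) ∈
    ([(0,8),(8,10),(10,9),(9,1),(8,9),(10,1),(1,2),(2,0),(0,3),(3,6),(6,7),(7,3),
      (2,4),(4,6),(6,5),(5,1),(4,7),(7,5)] : List (Fin 11 × Fin 11)))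

/-- The wheel `W₅`: a 5-cycle `0,…,4` together with a hub `5` adjacent to all of it. -/
def W5 : SimpleGraph (Fin 6) :=
  SimpleGraph.fromRel (fun a b => (a, b) ∈
    ([(0,1),(1,2),(2,3),(3,4),(4,0),(5,0),(5,1),(5,2),(5,3),(5,4)] : List (Fin 6 × Fin 6)))

/-- The exceptional 4-critical graphs: `K₄`, `H₇` (the 4-Ore graph on seven vertices),
`W₅`, `T₈`, `T₁₁`, and the 4-Ore graphs with `T = 3`. -/
def Exceptional {V : Type*} (G : SimpleGraph V) : Prop :=
  Nonempty (G ≃g (⊤ : SimpleGraph (Fin 4))) ∨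
  (∃ H₇ : SimpleGraph (Fin 7), IsFourOre H₇ ∧ Nonempty (G ≃g H₇)) ∨
  Nonempty (G ≃g W5) ∨ Nonempty (G ≃g T8) ∨ Nonempty (G ≃g T11) ∨
  (IsFourOre G ∧ maxTri G = 3)

/-- `G` is a minimum counterexample to the main theorem: a 4-critical graph with
`p(G) ≥ -1` which is not exceptional, such that every 4-critical graph on fewer vertices
satisfies the conclusion of the main theorem. -/
def MinCounterexample {V : Type*} (G : SimpleGraph V) : Prop :=
  FourCritical G ∧ -1 ≤ pot G ∧ ¬ Exceptional G ∧
  ∀ m : ℕ, m < Nat.card V → ∀ H : SimpleGraph (Fin m), FourCritical H →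
    Exceptional H ∨ pot H ≤ -2

/-- The φ-identification `G_φ(R)`: the color classes of `R` are identified to the three
vertices `Sum.inr i`, which form a triangle. -/
def identGraph {V : Type*} (G : SimpleGraph V) (R : Set V) (φ : V → Fin 3) :
    SimpleGraph ({v : V // v ∉ R} ⊕ Fin 3) :=
  SimpleGraph.fromRel (fun a b =>
    match a, b with
    | Sum.inl a, Sum.inl b => G.Adj a.1 b.1
    | Sum.inl a, Sum.inr i => ∃ r ∈ R, φ r = i ∧ G.Adj a.1 r
    | Sum.inr _, Sum.inr _ => True
    | Sum.inr _, Sum.inl _ => False)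

/-! ### Short cycles as explicit triangles and four-cycles -/

/-- `S` is the vertex set of a triangle or of a four-cycle of `G`. -/
def IsTriOrQuad {V : Type*} (G : SimpleGraph V) (S : Set V) : Prop :=
  (∃ a b c, G.Adj a b ∧ G.Adj b c ∧ G.Adj c a ∧ S = {a, b, c}) ∨
  (∃ a b c d, a ≠ c ∧ b ≠ d ∧ G.Adj a b ∧ G.Adj b c ∧ G.Adj c d ∧ G.Adj d a ∧
    S = {a, b, c, d})

/-- A diamond with degree-three vertices `a, b`, given by the exact neighbourhoods of these. -/
def ExactDiamond {V : Type*} (G : SimpleGraph V) (a b c d : V) : Prop :=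
  c ≠ d ∧ (∀ u, G.Adj a u ↔ u = b ∨ u = c ∨ u = d) ∧ (∀ u, G.Adj b u ↔ u = a ∨ u = c ∨ u = d)

/-- Some diamond of `G` does not contain `v`. -/
def DiamondAvoiding {V : Type*} (G : SimpleGraph V) (v : V) : Prop :=
  ∃ a b c d, ExactDiamond G a b c d ∧ a ≠ v ∧ b ≠ v ∧ c ≠ v ∧ d ≠ v

/-- Two disjoint short cycles of `G` do not contain `v`. -/
def TwoAvoiding {V : Type*} (G : SimpleGraph V) (v : V) : Prop :=
  ∃ S T, IsTriOrQuad G S ∧ IsTriOrQuad G T ∧ Disjoint S T ∧ v ∉ S ∧ v ∉ T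

/-- Every vertex of `G` is avoided by a short cycle. -/
def OneAvoidingAll {V : Type*} (G : SimpleGraph V) : Prop :=
  ∀ v, ∃ S, IsTriOrQuad G S ∧ v ∉ S

/-- Every vertex of `G` is avoided by a diamond or by two disjoint short cycles. -/
def DiamondOrTwoAvoiding {V : Type*} (G : SimpleGraph V) : Prop :=
  ∀ v, DiamondAvoiding G v ∨ TwoAvoiding G v

/-- `G` is a complete graph on four vertices. -/
def IsKFour {V : Type*} (G : SimpleGraph V) : Prop :=
  (∀ a b, G.Adj a b ↔ a ≠ b) ∧ ∀ x y : V, x ≠ y →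
    ∃ a b, a ≠ b ∧ a ≠ x ∧ a ≠ y ∧ b ≠ x ∧ b ≠ y ∧ ∀ u, u = x ∨ u = y ∨ u = a ∨ u = b

/-- Local structure which guarantees that every splitting of `v` leaves a diamond or three
disjoint short cycles. -/
def SplitRobust {V : Type*} (G : SimpleGraph V) (v : V) : Prop :=
  DiamondAvoiding G v ∨
  (∃ S T U, IsTriOrQuad G S ∧ IsTriOrQuad G T ∧ IsTriOrQuad G U ∧
    Disjoint S T ∧ Disjoint S U ∧ Disjoint T U ∧ v ∉ S ∧ v ∉ T ∧ v ∉ U) ∨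
  (∃ S T u c d, IsTriOrQuad G S ∧ IsTriOrQuad G T ∧ Disjoint S T ∧ v ∉ S ∧ v ∉ T ∧
    Disjoint S {u, c, d} ∧ Disjoint T {u, c, d} ∧ c ≠ d ∧
    G.Adj v u ∧ G.Adj v c ∧ G.Adj v d ∧ G.Adj u c ∧ G.Adj u d)

section ShortCycles

variable {V W : Type*} {G : SimpleGraph V} {G' : SimpleGraph W} {S : Set V}

theorem IsTriOrQuad.map (h : IsTriOrQuad G S) {f : V → W} (hf : Set.InjOn f S)
    (hadj : ∀ a ∈ S, ∀ b ∈ S, G.Adj a b → G'.Adj (f a) (f b)) : IsTriOrQuad G' (f '' S) := by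
  rcases h with ⟨a, b, c, hab, hbc, hca, rfl⟩ | ⟨a, b, c, d, hac, hbd, hab, hbc, hcd, hda, rfl⟩
  · refine Or.inl ⟨f a, f b, f c, hadj _ (by simp) _ (by simp) hab, hadj _ (by simp) _ (by simp) hbc,
      hadj _ (by simp) _ (by simp) hca, by simp [Set.image_insert_eq]⟩
  · refine Or.inr ⟨f a, f b, f c, f d, hf.ne (by simp) (by simp) hac,
      hf.ne (by simp) (by simp) hbd, hadj _ (by simp) _ (by simp) hab,
      hadj _ (by simp) _ (by simp) hbc, hadj _ (by simp) _ (by simp) hcd,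
      hadj _ (by simp) _ (by simp) hda, by simp [Set.image_insert_eq]⟩

theorem IsTriOrQuad.comap_val {z : V} (h : IsTriOrQuad G S) (hz : z ∉ S) :
    IsTriOrQuad (G.comap (Subtype.val : {v : V // v ≠ z} → V)) (Subtype.val ⁻¹' S) := by
  rcases h with ⟨a, b, c, hab, hbc, hca, rfl⟩ | ⟨a, b, c, d, hac, hbd, hab, hbc, hcd, hda, rfl⟩
  · simp only [Set.mem_insert_iff, Set.mem_singleton_iff, not_or] at hz
    refine Or.inl ⟨⟨a, Ne.symm hz.1⟩, ⟨b, Ne.symm hz.2.1⟩, ⟨c, Ne.symm hz.2.2⟩, hab, hbc, hca, ?_⟩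
    ext ⟨u, hu⟩
    simp
  · simp only [Set.mem_insert_iff, Set.mem_singleton_iff, not_or] at hz
    refine Or.inr ⟨⟨a, Ne.symm hz.1⟩, ⟨b, Ne.symm hz.2.1⟩, ⟨c, Ne.symm hz.2.2.1⟩,
      ⟨d, Ne.symm hz.2.2.2⟩, by simpa using hac, by simpa using hbd, hab, hbc, hcd, hda, ?_⟩
    ext ⟨u, hu⟩
    simp

theorem IsTriOrQuad.map_iso (e : G ≃g G') (h : IsTriOrQuad G S) : IsTriOrQuad G' (e '' S) :=
  h.map e.injective.injOn fun _ _ _ _ hab => e.map_adj_iff.2 hab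

theorem IsTriOrQuad.shortCycleSet (h : IsTriOrQuad G S) : ShortCycleSet G S := by
  rcases h with ⟨a, b, c, hab, hbc, hca, rfl⟩ | ⟨a, b, c, d, hac, hbd, hab, hbc, hcd, hda, rfl⟩
  · refine ⟨a, .cons hab (.cons hbc (.cons hca .nil)), ?_, by simp, ?_⟩
    · simp [Walk.isCycle_def, Walk.isTrail_def, hab.ne, hab.ne', hbc.ne, hca.ne, hca.ne']
    · ext u
      simp
      tauto
  · refine ⟨a, .cons hab (.cons hbc (.cons hcd (.cons hda .nil))), ?_, by simp, ?_⟩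
    · simp [Walk.isCycle_def, Walk.isTrail_def, hab.ne, hab.ne', hbc.ne, hcd.ne,
        hda.ne, hda.ne', hac, hac.symm, hbd]
    · ext u
      simp
      tauto

theorem IsTriOrQuad.nonempty (h : IsTriOrQuad G S) : S.Nonempty := by
  rcases h with ⟨a, b, c, -, -, -, rfl⟩ | ⟨a, b, c, d, -, -, -, -, -, -, rfl⟩ <;> exact ⟨a, by simp⟩

theorem ShortCycleSet.three_le_ncard (h : ShortCycleSet G S) : 3 ≤ S.ncard := by
  classical
  obtain ⟨v, w, hw, -, rfl⟩ := h
  have hsub : (w.support.tail.toFinset : Set V) ⊆ {x | x ∈ w.support} := fun x hx =>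
    List.mem_of_mem_tail (by simpa using hx)
  have hfin : {x | x ∈ w.support}.Finite := w.support.finite_toSet
  calc 3 ≤ w.length := hw.three_le_length
    _ = w.support.tail.toFinset.card := by
      rw [List.toFinset_card_of_nodup hw.support_nodup]; simp
    _ = (w.support.tail.toFinset : Set V).ncard := (Set.ncard_coe_finset _).symm
    _ ≤ _ := Set.ncard_le_ncard hsub hfin

/-- The union of a packing of `k` short cycles has at least `3 * k` elements. -/
theorem three_mul_card_le_of_packing [Finite V] (C : Finset (Set V))
    (hC : ∀ S ∈ C, ShortCycleSet G S) (hdisj : (C : Set (Set V)).Pairwise Disjoint) :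
    3 * C.card ≤ Nat.card V := by
  classical
  have : Fintype V := Fintype.ofFinite V
  have h1 : (C.biUnion fun S => S.toFinset).card = ∑ S ∈ C, S.toFinset.card :=
    Finset.card_biUnion fun S hS T hT hST => Set.disjoint_toFinset.2 (hdisj hS hT hST)
  have h2 : ∑ _S ∈ C, 3 ≤ ∑ S ∈ C, S.toFinset.card := Finset.sum_le_sum fun S hS => by
    rw [← Set.ncard_eq_toFinset_card']
    exact (hC S hS).three_le_ncard
  have h3 := Finset.card_le_univ (C.biUnion fun S => S.toFinset)
  rw [Finset.sum_const, smul_eq_mul] at h2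
  rw [Nat.card_eq_fintype_card]
  omega

theorem three_mul_maxTri_le [Finite V] (G : SimpleGraph V) : 3 * maxTri G ≤ Nat.card V := by
  have hmem := Nat.sSup_mem (s := {n | ∃ C : Finset (Set V), C.card = n ∧
    (∀ S ∈ C, ShortCycleSet G S) ∧ (C : Set (Set V)).Pairwise Disjoint})
    ⟨0, ∅, by simp⟩ ⟨Nat.card V, by
      rintro n ⟨C, rfl, hC, hd⟩
      have := three_mul_card_le_of_packing C hC hd
      omega⟩
  obtain ⟨C, hcard, hC, hd⟩ := hmem
  rw [maxTri, ← hcard]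
  exact three_mul_card_le_of_packing C hC hd

theorem three_le_maxTri [Finite V] {S T U : Set V} (hS : IsTriOrQuad G S) (hT : IsTriOrQuad G T)
    (hU : IsTriOrQuad G U) (hST : Disjoint S T) (hSU : Disjoint S U) (hTU : Disjoint T U) :
    3 ≤ maxTri G := by
  classical
  refine le_csSup ⟨Nat.card V, ?_⟩ ⟨{S, T, U}, ?_, ?_, ?_⟩
  · rintro n ⟨C, rfl, hC, hd⟩
    have := three_mul_card_le_of_packing C hC hd
    omega
  · exact Finset.card_eq_three.2 ⟨S, T, U, hST.ne hS.nonempty.ne_empty,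
      hSU.ne hS.nonempty.ne_empty, hTU.ne hT.nonempty.ne_empty, rfl⟩
  · simp only [Finset.mem_insert, Finset.mem_singleton]
    rintro X (rfl | rfl | rfl)
    exacts [hS.shortCycleSet, hT.shortCycleSet, hU.shortCycleSet]
  · rintro X hX Y hY hXY
    simp only [Finset.coe_insert, Finset.coe_singleton, Set.mem_insert_iff,
      Set.mem_singleton_iff] at hX hY
    rcases hX with rfl | rfl | rfl <;> rcases hY with rfl | rfl | rfl <;>
      first
      | exact absurd rfl hXY
      | assumption
      | exact Disjoint.symm ‹_›

end ShortCycles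

/-! ### Invariance under isomorphism -/

section Iso

variable {V W : Type*} {G : SimpleGraph V} {G' : SimpleGraph W}

theorem ExactDiamond.map_iso (e : G ≃g G') {a b c d : V} (h : ExactDiamond G a b c d) :
    ExactDiamond G' (e a) (e b) (e c) (e d) := by
  refine ⟨e.injective.ne h.1, fun u => ?_, fun u => ?_⟩ <;>
    obtain ⟨u, rfl⟩ := e.surjective u <;>
    simp only [e.map_adj_iff, e.injective.eq_iff]
  exacts [h.2.1 u, h.2.2 u]

theorem DiamondAvoiding.map_iso (e : G ≃g G') {v : V} (h : DiamondAvoiding G v) :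
    DiamondAvoiding G' (e v) := by
  obtain ⟨a, b, c, d, h, ha, hb, hc, hd⟩ := h
  exact ⟨_, _, _, _, h.map_iso e, e.injective.ne ha, e.injective.ne hb, e.injective.ne hc,
    e.injective.ne hd⟩

theorem TwoAvoiding.map_iso (e : G ≃g G') {v : V} (h : TwoAvoiding G v) :
    TwoAvoiding G' (e v) := by
  obtain ⟨S, T, hS, hT, hd, hvS, hvT⟩ := h
  exact ⟨_, _, hS.map_iso e, hT.map_iso e, (Set.disjoint_image_iff e.injective).2 hd,
    by simpa using hvS, by simpa using hvT⟩

theorem OneAvoidingAll.map_iso (e : G ≃g G') (h : OneAvoidingAll G) : OneAvoidingAll G' := by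
  intro v
  obtain ⟨v, rfl⟩ := e.surjective v
  obtain ⟨S, hS, hv⟩ := h v
  exact ⟨_, hS.map_iso e, by simpa using hv⟩

theorem DiamondOrTwoAvoiding.map_iso (e : G ≃g G') (h : DiamondOrTwoAvoiding G) :
    DiamondOrTwoAvoiding G' := by
  intro v
  obtain ⟨v, rfl⟩ := e.surjective v
  exact (h v).imp (·.map_iso e) (·.map_iso e)

theorem SplitRobust.map_iso (e : G ≃g G') {v : V} (h : SplitRobust G v) :
    SplitRobust G' (e v) := by
  have hdis {S T : Set V} (h : Disjoint S T) : Disjoint (e '' S) (e '' T) :=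
    (Set.disjoint_image_iff e.injective).2 h
  rcases h with h | ⟨S, T, U, hS, hT, hU, hST, hSU, hTU, hvS, hvT, hvU⟩ |
    ⟨S, T, u, c, d, hS, hT, hST, hvS, hvT, hSd, hTd, hcd, hvu, hvc, hvd, huc, hud⟩
  · exact Or.inl (h.map_iso e)
  · exact Or.inr (Or.inl ⟨_, _, _, hS.map_iso e, hT.map_iso e, hU.map_iso e, hdis hST, hdis hSU,
      hdis hTU, by simpa using hvS, by simpa using hvT, by simpa using hvU⟩)
  · refine Or.inr (Or.inr ⟨_, _, e u, e c, e d, hS.map_iso e, hT.map_iso e, hdis hST,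
      by simpa using hvS, by simpa using hvT, ?_, ?_, e.injective.ne hcd, e.map_adj_iff.2 hvu,
      e.map_adj_iff.2 hvc, e.map_adj_iff.2 hvd, e.map_adj_iff.2 huc, e.map_adj_iff.2 hud⟩)
    · simpa [Set.image_insert_eq] using hdis hSd
    · simpa [Set.image_insert_eq] using hdis hTd

end Iso

/-! ### Ore compositions -/

section Ore

variable {V₁ V₂ : Type*} {G₁ : SimpleGraph V₁} {x y : V₁} {G₂ : SimpleGraph V₂} {z : V₂}
  {A : Set V₂}

theorem oreGraph_adj_inl_inl {a b : V₁} : (oreGraph G₁ x y G₂ z A).Adj (.inl a) (.inl b) ↔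
    G₁.Adj a b ∧ ¬(a = x ∧ b = y) ∧ ¬(a = y ∧ b = x) := by
  simp only [oreGraph, SimpleGraph.fromRel_adj, ne_eq, Sum.inl.injEq, G₁.adj_comm b a]
  have := G₁.ne_of_adj (a := a) (b := b)
  tauto

theorem oreGraph_adj_inr_inr {a b : {v : V₂ // v ≠ z}} :
    (oreGraph G₁ x y G₂ z A).Adj (.inr a) (.inr b) ↔ G₂.Adj a b := by
  simp only [oreGraph, SimpleGraph.fromRel_adj, ne_eq, Sum.inr.injEq, G₂.adj_comm b a, or_self,
    and_iff_right_iff_imp]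
  rintro h rfl
  exact h.ne rfl

theorem oreGraph_adj_inl_inr {a : V₁} {b : {v : V₂ // v ≠ z}} :
    (oreGraph G₁ x y G₂ z A).Adj (.inl a) (.inr b) ↔
      G₂.Adj z b ∧ ((a = x ∧ b.1 ∈ A) ∨ (a = y ∧ b.1 ∉ A)) := by
  simp [oreGraph, SimpleGraph.fromRel_adj]

theorem oreGraph_adj_inr_inl {a : V₁} {b : {v : V₂ // v ≠ z}} :
    (oreGraph G₁ x y G₂ z A).Adj (.inr b) (.inl a) ↔
      G₂.Adj z b ∧ ((a = x ∧ b.1 ∈ A) ∨ (a = y ∧ b.1 ∉ A)) := by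
  rw [SimpleGraph.adj_comm, oreGraph_adj_inl_inr]

theorem oreGraph_swap : oreGraph G₁ x y G₂ z A = oreGraph G₁ y x G₂ z Aᶜ := by
  ext (a | a) (b | b) <;>
    simp only [oreGraph_adj_inl_inl, oreGraph_adj_inr_inr, oreGraph_adj_inl_inr,
      oreGraph_adj_inr_inl, Set.mem_compl_iff, not_not] <;> tauto

theorem IsTriOrQuad.oreGraph_left_of_deleteEdges {S : Set V₁}
    (h : IsTriOrQuad (G₁.deleteEdges {s(x, y)}) S) :
    IsTriOrQuad (oreGraph G₁ x y G₂ z A) (Sum.inl '' S) := by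
  refine h.map Sum.inl_injective.injOn fun a _ b _ hab => ?_
  rw [SimpleGraph.deleteEdges_adj] at hab
  rw [oreGraph_adj_inl_inl]
  simp only [Set.mem_singleton_iff, Sym2.eq_iff, not_or] at hab
  exact hab

theorem IsTriOrQuad.deleteEdges {S : Set V₁} (h : IsTriOrQuad G₁ S) (hx : x ∉ S) :
    IsTriOrQuad (G₁.deleteEdges {s(x, y)}) S := by
  have := h.map (G' := G₁.deleteEdges {s(x, y)}) (f := id) Function.injective_id.injOn ?_
  · simpa using this
  intro a ha b hb hab
  simp only [id, SimpleGraph.deleteEdges_adj, Set.mem_singleton_iff, Sym2.eq_iff]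
  refine ⟨hab, ?_⟩
  rintro (⟨rfl, rfl⟩ | ⟨rfl, rfl⟩) <;> contradiction

theorem IsTriOrQuad.oreGraph_left {S : Set V₁} (h : IsTriOrQuad G₁ S) (hx : x ∉ S) :
    IsTriOrQuad (oreGraph G₁ x y G₂ z A) (Sum.inl '' S) :=
  (h.deleteEdges hx).oreGraph_left_of_deleteEdges

theorem IsTriOrQuad.oreGraph_right {S : Set V₂} (h : IsTriOrQuad G₂ S) (hz : z ∉ S) :
    IsTriOrQuad (oreGraph G₁ x y G₂ z A) (Sum.inr '' (Subtype.val ⁻¹' S)) :=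
  (h.comap_val hz).map Sum.inr_injective.injOn fun _ _ _ _ hab => oreGraph_adj_inr_inr.2 hab

theorem disjoint_inl_image_inr_image {α β : Type*} (S : Set α) (T : Set β) :
    Disjoint (Sum.inl '' S : Set (α ⊕ β)) (Sum.inr '' T) := by
  rw [Set.disjoint_left]
  rintro _ ⟨a, -, rfl⟩ ⟨b, -, h⟩
  cases h

theorem disjoint_inl_image {α β : Type*} {S T : Set α} (h : Disjoint S T) :
    Disjoint (Sum.inl '' S : Set (α ⊕ β)) (Sum.inl '' T) :=
  (Set.disjoint_image_iff Sum.inl_injective).2 h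

theorem disjoint_inr_image_preimage_val {α β : Type*} {p : β → Prop} {S T : Set β}
    (h : Disjoint S T) : Disjoint (Sum.inr '' (Subtype.val ⁻¹' S) : Set (α ⊕ Subtype p))
      (Sum.inr '' (Subtype.val ⁻¹' T)) :=
  (Set.disjoint_image_iff Sum.inr_injective).2 (h.preimage _)

theorem ExactDiamond.oreGraph_left (hxy : G₁.Adj x y) {a b c d : V₁}
    (h : ExactDiamond G₁ a b c d) (ha : a ≠ x) (hb : b ≠ x) (hc : c ≠ x) (hd : d ≠ x) :
    ExactDiamond (oreGraph G₁ x y G₂ z A) (.inl a) (.inl b) (.inl c) (.inl d) := by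
  obtain ⟨hcd, hna, hnb⟩ := h
  have hay : a ≠ y := by
    rintro rfl
    rcases (hna x).1 hxy.symm with h | h | h <;> exact absurd h.symm ‹_›
  have hby : b ≠ y := by
    rintro rfl
    rcases (hnb x).1 hxy.symm with h | h | h <;> exact absurd h.symm ‹_›
  refine ⟨by simpa using hcd, ?_, ?_⟩ <;> rintro (u | u) <;>
    simp [oreGraph_adj_inl_inl, oreGraph_adj_inl_inr, *]

theorem ExactDiamond.oreGraph_right {a b c d : V₂} (h : ExactDiamond G₂ a b c d) (ha : a ≠ z)
    (hb : b ≠ z) (hc : c ≠ z) (hd : d ≠ z) :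
    ExactDiamond (oreGraph G₁ x y G₂ z A) (.inr ⟨a, ha⟩) (.inr ⟨b, hb⟩) (.inr ⟨c, hc⟩)
      (.inr ⟨d, hd⟩) := by
  obtain ⟨hcd, hna, hnb⟩ := h
  have haz : ¬ G₂.Adj z a := fun h => by
    rcases (hna z).1 h.symm with h | h | h <;> exact absurd h.symm ‹_›
  have hbz : ¬ G₂.Adj z b := fun h => by
    rcases (hnb z).1 h.symm with h | h | h <;> exact absurd h.symm ‹_›
  refine ⟨by simpa using hcd, ?_, ?_⟩ <;> rintro (u | u) <;>
    simp [oreGraph_adj_inr_inl, oreGraph_adj_inr_inr, Subtype.ext_iff, *]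

theorem IsKFour.exactDiamond_oreGraph_left (h : IsKFour G₁) {a b : V₁} (hxy : x ≠ y)
    (hab : a ≠ b) (hax : a ≠ x) (hay : a ≠ y) (hbx : b ≠ x) (hby : b ≠ y)
    (hcov : ∀ u, u = x ∨ u = y ∨ u = a ∨ u = b) :
    ExactDiamond (oreGraph G₁ x y G₂ z A) (.inl a) (.inl b) (.inl x) (.inl y) := by
  refine ⟨by simpa using hxy, ?_, ?_⟩ <;> rintro (u | u) <;>
    simp only [oreGraph_adj_inl_inl, oreGraph_adj_inl_inr, h.1, Sum.inl.injEq, reduceCtorEq] <;>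
    try tauto
  · have := hcov u
    grind
  · have := hcov u
    grind

/-- Splitting a vertex `z` of `K₄` separates one neighbour `c` from the two others. -/
theorem IsKFour.exists_split (h : IsKFour G₂) (hA : (A ∩ G₂.neighborSet z).Nonempty)
    (hA' : (G₂.neighborSet z \ A).Nonempty) :
    ∃ a b c, a ≠ z ∧ b ≠ z ∧ c ≠ z ∧ a ≠ b ∧ a ≠ c ∧ b ≠ c ∧
      (∀ u, u = z ∨ u = a ∨ u = b ∨ u = c) ∧
      ((a ∈ A ∧ b ∈ A ∧ c ∉ A) ∨ (a ∉ A ∧ b ∉ A ∧ c ∈ A)) := by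
  obtain ⟨p, hpA, hp⟩ := hA
  obtain ⟨q, hq, hqA⟩ := hA'
  rw [SimpleGraph.mem_neighborSet, h.1] at hp hq
  have hpq : p ≠ q := by rintro rfl; exact hqA hpA
  obtain ⟨r, hrz, hrp, hrq, hcov⟩ : ∃ r, r ≠ z ∧ r ≠ p ∧ r ≠ q ∧
      ∀ u, u = z ∨ u = p ∨ u = q ∨ u = r := by
    obtain ⟨a, b, hab, hap, haq, hbp, hbq, hcov⟩ := h.2 p q hpq
    rcases hcov z with hz | hz | hz | hz
    · exact absurd hz hp
    · exact absurd hz hq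
    · subst hz
      exact ⟨b, hab.symm, hbp, hbq, fun u => by have := hcov u; tauto⟩
    · subst hz
      exact ⟨a, hab, hap, haq, fun u => by have := hcov u; tauto⟩
  by_cases hr : r ∈ A
  · exact ⟨p, r, q, hp.symm, hrz, hq.symm, hrp.symm, hpq, hrq,
      fun u => by have := hcov u; tauto, Or.inl ⟨hpA, hr, hqA⟩⟩
  · exact ⟨q, r, p, hq.symm, hrz, hp.symm, hrq.symm, hpq.symm, hrp,
      fun u => by have := hcov u; tauto, Or.inr ⟨hqA, hr, hpA⟩⟩

theorem IsKFour.exactDiamond_oreGraph_right (h : IsKFour G₂) {a b c : V₂}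
    (ha : a ≠ z) (hb : b ≠ z) (hc : c ≠ z) (hab : a ≠ b) (hac : a ≠ c) (hbc : b ≠ c)
    (hcov : ∀ u, u = z ∨ u = a ∨ u = b ∨ u = c) (haA : a ∈ A) (hbA : b ∈ A) :
    ExactDiamond (oreGraph G₁ x y G₂ z A) (.inr ⟨a, ha⟩) (.inr ⟨b, hb⟩) (.inr ⟨c, hc⟩)
      (.inl x) := by
  refine ⟨by simp, ?_, ?_⟩ <;> rintro (u | ⟨u, hu⟩) <;>
    simp only [oreGraph_adj_inr_inl, oreGraph_adj_inr_inr, h.1, Sum.inl.injEq, Sum.inr.injEq,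
      reduceCtorEq, Subtype.mk.injEq]
  · tauto
  · have := hcov u
    grind
  · tauto
  · have := hcov u
    grind

theorem oreGraph_oneAvoidingAll (h₁ : OneAvoidingAll G₁) (h₂ : OneAvoidingAll G₂) :
    OneAvoidingAll (oreGraph G₁ x y G₂ z A) := by
  rintro (p | w)
  · obtain ⟨S, hS, hz⟩ := h₂ z
    exact ⟨_, hS.oreGraph_right hz, by simp⟩
  · obtain ⟨S, hS, hx⟩ := h₁ x
    exact ⟨_, hS.oreGraph_left hx, by simp⟩

theorem IsTriOrQuad.of_exactDiamond {V : Type*} {G : SimpleGraph V} {a b c d : V}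
    (h : ExactDiamond G a b c d) : IsTriOrQuad G {a, b, c} :=
  Or.inl ⟨a, b, c, (h.2.1 b).2 (by simp), (h.2.2 c).2 (by simp), ((h.2.1 c).2 (by simp)).symm, rfl⟩

theorem ExactDiamond.swap_tips {V : Type*} {G : SimpleGraph V} {a b c d : V}
    (h : ExactDiamond G a b c d) : ExactDiamond G a b d c :=
  ⟨h.1.symm, fun u => by rw [h.2.1]; tauto, fun u => by rw [h.2.2]; tauto⟩

theorem ExactDiamond.swap_spine {V : Type*} {G : SimpleGraph V} {a b c d : V}
    (h : ExactDiamond G a b c d) : ExactDiamond G b a c d :=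
  ⟨h.1, h.2.2, h.2.1⟩

/-- Deleting one edge of a diamond leaves a short cycle. -/
theorem ExactDiamond.exists_deleteEdges {a b c d : V₁} (h : ExactDiamond G₁ a b c d) :
    ∃ S, IsTriOrQuad (G₁.deleteEdges {s(x, y)}) S ∧ S ⊆ {a, b, c, d} := by
  have hab := (h.2.1 b).2 (by simp)
  have hac := (h.2.1 c).2 (by simp)
  have had := (h.2.1 d).2 (by simp)
  have hbc := (h.2.2 c).2 (by simp)
  have hbd := (h.2.2 d).2 (by simp)
  by_cases hxy : s(x, y) = s(a, b)
  · refine ⟨{a, c, b, d}, Or.inr ⟨a, c, b, d, hab.ne, h.1, ?_⟩, by intro u; simp; tauto⟩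
    rw [hxy]
    simp only [SimpleGraph.deleteEdges_adj, Set.mem_singleton_iff, Sym2.eq_iff]
    refine ⟨⟨hac, ?_⟩, ⟨hbc.symm, ?_⟩, ⟨hbd, ?_⟩, ⟨had.symm, ?_⟩, trivial⟩ <;>
      rintro (⟨h₁, h₂⟩ | ⟨h₁, h₂⟩) <;> simp_all
  · by_cases hc : s(x, y) = s(b, c) ∨ s(x, y) = s(c, a)
    · refine ⟨{a, b, d}, Or.inl ⟨a, b, d, ?_⟩, by intro u; simp; tauto⟩
      simp only [SimpleGraph.deleteEdges_adj, Set.mem_singleton_iff]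
      refine ⟨⟨hab, Ne.symm hxy⟩, ⟨hbd, ?_⟩, ⟨had.symm, ?_⟩, trivial⟩ <;>
        rcases hc with hc | hc <;> rw [hc, Sym2.eq_iff] <;> have := h.1 <;>
        rintro (⟨h₁, h₂⟩ | ⟨h₁, h₂⟩) <;> simp_all
    · push Not at hc
      refine ⟨{a, b, c}, Or.inl ⟨a, b, c, ?_⟩, by intro u; simp; tauto⟩
      simp only [SimpleGraph.deleteEdges_adj, Set.mem_singleton_iff]
      exact ⟨⟨hab, Ne.symm hxy⟩, ⟨hbc, hc.1.symm⟩, ⟨hac.symm, hc.2.symm⟩, trivial⟩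

theorem DiamondAvoiding.oreGraph_left_inl (hxy : G₁.Adj x y) (h : DiamondAvoiding G₁ x) :
    DiamondAvoiding (oreGraph G₁ x y G₂ z A) (.inl x) := by
  obtain ⟨a, b, c, d, h, ha, hb, hc, hd⟩ := h
  exact ⟨_, _, _, _, h.oreGraph_left hxy ha hb hc hd, by simpa, by simpa, by simpa, by simpa⟩

theorem DiamondAvoiding.oreGraph_left_inr (hxy : G₁.Adj x y) (h : DiamondAvoiding G₁ x)
    (w : {v : V₂ // v ≠ z}) : DiamondAvoiding (oreGraph G₁ x y G₂ z A) (.inr w) := by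
  obtain ⟨a, b, c, d, h, ha, hb, hc, hd⟩ := h
  exact ⟨_, _, _, _, h.oreGraph_left hxy ha hb hc hd, by simp, by simp, by simp, by simp⟩

theorem DiamondAvoiding.oreGraph_right (h : DiamondAvoiding G₂ z) (p : V₁) :
    DiamondAvoiding (oreGraph G₁ x y G₂ z A) (.inl p) := by
  obtain ⟨a, b, c, d, h, ha, hb, hc, hd⟩ := h
  exact ⟨_, _, _, _, h.oreGraph_right ha hb hc hd, by simp, by simp, by simp, by simp⟩

theorem IsKFour.diamondAvoiding_oreGraph (h : IsKFour G₁) (hxy : x ≠ y)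
    (w : {v : V₂ // v ≠ z}) : DiamondAvoiding (oreGraph G₁ x y G₂ z A) (.inr w) := by
  obtain ⟨a, b, hab, hax, hay, hbx, hby, hcov⟩ := h.2 x y hxy
  exact ⟨_, _, _, _, h.exactDiamond_oreGraph_left hxy hab hax hay hbx hby hcov, by simp, by simp,
    by simp, by simp⟩

theorem TwoAvoiding.oreGraph_right (h : TwoAvoiding G₂ z) (p : V₁) :
    TwoAvoiding (oreGraph G₁ x y G₂ z A) (.inl p) := by
  obtain ⟨S, T, hS, hT, hd, hzS, hzT⟩ := h
  exact ⟨_, _, hS.oreGraph_right hzS, hT.oreGraph_right hzT, disjoint_inr_image_preimage_val hd,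
    by simp, by simp⟩

/-- When the split side is `K₄`, each vertex of the edge side is avoided by a diamond unless it is
the root which receives two edges; in that case a triangle of the split side avoids it. -/
theorem IsKFour.oreGraph_cases (h : IsKFour G₂)
    (hA : (A ∩ G₂.neighborSet z).Nonempty) (hA' : (G₂.neighborSet z \ A).Nonempty) (p : V₁) :
    DiamondAvoiding (oreGraph G₁ x y G₂ z A) (.inl p) ∨
      (p = x ∨ p = y) ∧ ∃ S, IsTriOrQuad G₂ S ∧ z ∉ S := by
  obtain ⟨a, b, c, ha, hb, hc, hab, hac, hbc, hcov, hside⟩ := h.exists_split hA hA'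
  have htri : ∃ S, IsTriOrQuad G₂ S ∧ z ∉ S :=
    ⟨{a, b, c}, Or.inl ⟨a, b, c, (h.1 _ _).2 hab, (h.1 _ _).2 hbc, (h.1 _ _).2 hac.symm, rfl⟩,
      by simp [ha.symm, hb.symm, hc.symm]⟩
  rcases hside with ⟨haA, hbA, -⟩ | ⟨haA, hbA, -⟩
  · by_cases hp : p = x
    · exact Or.inr ⟨Or.inl hp, htri⟩
    · exact Or.inl ⟨_, _, _, _, h.exactDiamond_oreGraph_right ha hb hc hab hac hbc hcov haA hbA,
        by simp, by simp, by simp, by simpa using Ne.symm hp⟩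
  · by_cases hp : p = y
    · exact Or.inr ⟨Or.inr hp, htri⟩
    · rw [oreGraph_swap]
      exact Or.inl ⟨_, _, _, _, h.exactDiamond_oreGraph_right ha hb hc hab hac hbc hcov haA hbA,
        by simp, by simp, by simp, by simpa using Ne.symm hp⟩

theorem oreGraph_diamondOrTwoAvoiding (hxy : G₁.Adj x y)
    (hA : (A ∩ G₂.neighborSet z).Nonempty) (hA' : (G₂.neighborSet z \ A).Nonempty)
    (h₁ : OneAvoidingAll G₁) (h₁' : IsKFour G₁ ∨ DiamondOrTwoAvoiding G₁)
    (h₂' : IsKFour G₂ ∨ DiamondOrTwoAvoiding G₂) :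
    DiamondOrTwoAvoiding (oreGraph G₁ x y G₂ z A) := by
  rintro (p | w)
  · rcases h₂' with h₂' | h₂'
    · obtain h | ⟨hp, T, hT, hz⟩ := h₂'.oreGraph_cases hA hA' p
      · exact Or.inl h
      · obtain ⟨S, hS, hpS⟩ := h₁ p
        refine Or.inr ⟨_, _, ?_, hT.oreGraph_right hz, disjoint_inl_image_inr_image S _,
          by simpa using hpS, by simp⟩
        rcases hp with rfl | rfl
        · exact hS.oreGraph_left hpS
        · rw [oreGraph_swap]
          exact hS.oreGraph_left hpS
    · exact (h₂' z).imp (·.oreGraph_right p) (·.oreGraph_right p)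
  · rcases h₁' with h₁' | h₁'
    · exact Or.inl (h₁'.diamondAvoiding_oreGraph hxy.ne w)
    · refine (h₁' x).imp (·.oreGraph_left_inr hxy w) ?_
      rintro ⟨S, T, hS, hT, hd, hxS, hxT⟩
      exact ⟨_, _, hS.oreGraph_left hxS, hT.oreGraph_left hxT, disjoint_inl_image hd, by simp,
        by simp⟩

/-- A root of an Ore composition other than `K₄ ∘ K₄` is robust. -/
theorem oreGraph_splitRobust_root (hxy : G₁.Adj x y)
    (hA : (A ∩ G₂.neighborSet z).Nonempty) (hA' : (G₂.neighborSet z \ A).Nonempty)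
    (h₁ : OneAvoidingAll G₁) (h₁' : IsKFour G₁ ∨ DiamondOrTwoAvoiding G₁)
    (h₂' : IsKFour G₂ ∨ DiamondOrTwoAvoiding G₂) (hne : ¬ (IsKFour G₁ ∧ IsKFour G₂)) :
    SplitRobust (oreGraph G₁ x y G₂ z A) (.inl x) := by
  rcases h₂' with h₂ | h₂
  · have h₁'' := h₁'.resolve_left fun h => hne ⟨h, h₂⟩
    obtain h | ⟨-, U, hU, hz⟩ := h₂.oreGraph_cases hA hA' x
    · exact Or.inl h
    · obtain h | ⟨S, T, hS, hT, hd, hxS, hxT⟩ := h₁'' x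
      · exact Or.inl (h.oreGraph_left_inl hxy)
      · exact Or.inr (Or.inl ⟨_, _, _, hS.oreGraph_left hxS, hT.oreGraph_left hxT,
          hU.oreGraph_right hz, disjoint_inl_image hd, disjoint_inl_image_inr_image _ _,
          disjoint_inl_image_inr_image _ _, by simpa using hxS, by simpa using hxT, by simp⟩)
  · obtain h | ⟨S, T, hS, hT, hd, hzS, hzT⟩ := h₂ z
    · exact Or.inl (h.oreGraph_right x)
    · obtain ⟨U, hU, hxU⟩ := h₁ x
      exact Or.inr (Or.inl ⟨_, _, _, hU.oreGraph_left hxU, hS.oreGraph_right hzS,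
        hT.oreGraph_right hzT, disjoint_inl_image_inr_image _ _, disjoint_inl_image_inr_image _ _,
        disjoint_inr_image_preimage_val hd, by simpa using hxU, by simp, by simp⟩)

theorem oreGraph_splitRobust_inl (hxy : G₁.Adj x y)
    (hA : (A ∩ G₂.neighborSet z).Nonempty) (hA' : (G₂.neighborSet z \ A).Nonempty)
    (h₁' : IsKFour G₁ ∨ DiamondOrTwoAvoiding G₁)
    (h₂' : IsKFour G₂ ∨ DiamondOrTwoAvoiding G₂) {p : V₁} (hpx : p ≠ x) (hpy : p ≠ y) :
    SplitRobust (oreGraph G₁ x y G₂ z A) (.inl p) := by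
  rcases h₂' with h₂ | h₂
  · exact Or.inl ((h₂.oreGraph_cases hA hA' p).resolve_right (by tauto))
  obtain h | ⟨S, T, hS, hT, hd, hzS, hzT⟩ := h₂ z
  · exact Or.inl (h.oreGraph_right p)
  have of_cycle {U : Set V₁} (hU : IsTriOrQuad (G₁.deleteEdges {s(x, y)}) U) (hp : p ∉ U) :
      SplitRobust (oreGraph G₁ x y G₂ z A) (.inl p) :=
    Or.inr (Or.inl ⟨_, _, _, hU.oreGraph_left_of_deleteEdges, hS.oreGraph_right hzS,
      hT.oreGraph_right hzT, disjoint_inl_image_inr_image _ _, disjoint_inl_image_inr_image _ _,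
      disjoint_inr_image_preimage_val hd, by simpa using hp, by simp, by simp⟩)
  rcases h₁' with h₁ | h₁
  · obtain ⟨u, hup, hux, huy⟩ : ∃ u, u ≠ p ∧ u ≠ x ∧ u ≠ y := by
      obtain ⟨a, b, hab, hax, hay, hbx, hby, -⟩ := h₁.2 x y hxy.ne
      by_cases hap : a = p
      · exact ⟨b, fun h => hab (hap.trans h.symm), hbx, hby⟩
      · exact ⟨a, hap, hax, hay⟩
    have hset : ({Sum.inl u, Sum.inl x, Sum.inl y} : Set (V₁ ⊕ {v : V₂ // v ≠ z})) =
        Sum.inl '' {u, x, y} := by simp [Set.image_insert_eq]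
    refine Or.inr (Or.inr ⟨_, _, .inl u, .inl x, .inl y, hS.oreGraph_right hzS,
      hT.oreGraph_right hzT, disjoint_inr_image_preimage_val hd, by simp, by simp, ?_, ?_,
      by simpa using hxy.ne, ?_, ?_, ?_, ?_, ?_⟩)
    · rw [hset]
      exact (disjoint_inl_image_inr_image _ _).symm
    · rw [hset]
      exact (disjoint_inl_image_inr_image _ _).symm
    all_goals
      rw [oreGraph_adj_inl_inl, h₁.1]
      grind
  · obtain ⟨a, b, c, d, hD, ha, hb, hc, hd'⟩ | ⟨U, U', hU, hU', hdU, hpU, hpU'⟩ := h₁ p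
    · obtain ⟨U, hU, hsub⟩ := hD.exists_deleteEdges (x := x) (y := y)
      refine of_cycle hU fun hp => ?_
      have := hsub hp
      simp only [Set.mem_insert_iff, Set.mem_singleton_iff] at this
      grind
    · by_cases hx : x ∈ U
      · exact of_cycle (hU'.deleteEdges (Set.disjoint_left.1 hdU hx)) hpU'
      · exact of_cycle (hU.deleteEdges hx) hpU

theorem oreGraph_splitRobust_inr_of_isKFour (h₂ : IsKFour G₂) (h : TwoAvoiding G₁ x)
    {a b c : V₂} (ha : a ≠ z) (hb : b ≠ z) (hc : c ≠ z) (hab : a ≠ b) (hac : a ≠ c) (hbc : b ≠ c)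
    (hcov : ∀ u, u = z ∨ u = a ∨ u = b ∨ u = c) (haA : a ∈ A) (hbA : b ∈ A)
    (w : {v : V₂ // v ≠ z}) : SplitRobust (oreGraph G₁ x y G₂ z A) (.inr w) := by
  obtain ⟨S, T, hS, hT, hd, hxS, hxT⟩ := h
  have hdis {S : Set V₁} (hxS : x ∉ S) (p q : {v : V₂ // v ≠ z}) :
      Disjoint (Sum.inl '' S : Set (V₁ ⊕ {v : V₂ // v ≠ z})) {.inr p, .inr q, .inl x} := by
    simp [Set.disjoint_left]
    rintro a ha rfl
    exact hxS ha
  have hadj {p : V₂} (hp : p ≠ z) (hpA : p ∈ A) :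
      (oreGraph G₁ x y G₂ z A).Adj (.inr ⟨p, hp⟩) (.inl x) := by
    rw [oreGraph_adj_inr_inl]
    exact ⟨(h₂.1 _ _).2 hp.symm, Or.inl ⟨rfl, hpA⟩⟩
  have hadj' (p q : {v : V₂ // v ≠ z}) (hpq : p.1 ≠ q.1) :
      (oreGraph G₁ x y G₂ z A).Adj (.inr p) (.inr q) := by
    rw [oreGraph_adj_inr_inr]
    exact (h₂.1 _ _).2 hpq
  obtain ⟨w, hw⟩ := w
  rcases hcov w with h | h | h | h
  · exact absurd h hw
  all_goals subst h
  · exact Or.inr (Or.inr ⟨_, _, .inr ⟨b, hb⟩, .inr ⟨c, hc⟩, .inl x, hS.oreGraph_left hxS,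
      hT.oreGraph_left hxT, disjoint_inl_image hd, by simp, by simp, hdis hxS _ _, hdis hxT _ _,
      by simp, hadj' _ _ hab, hadj' _ _ hac, hadj ha haA, hadj' _ _ hbc, hadj hb hbA⟩)
  · exact Or.inr (Or.inr ⟨_, _, .inr ⟨a, ha⟩, .inr ⟨c, hc⟩, .inl x, hS.oreGraph_left hxS,
      hT.oreGraph_left hxT, disjoint_inl_image hd, by simp, by simp, hdis hxS _ _, hdis hxT _ _,
      by simp, hadj' _ _ hab.symm, hadj' _ _ hbc, hadj hb hbA, hadj' _ _ hac, hadj ha haA⟩)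
  · exact Or.inr (Or.inl ⟨_, _, {.inr ⟨a, ha⟩, .inr ⟨b, hb⟩, .inl x}, hS.oreGraph_left hxS,
      hT.oreGraph_left hxT, Or.inl ⟨_, _, _, hadj' _ _ hab, hadj hb hbA, (hadj ha haA).symm, rfl⟩,
      disjoint_inl_image hd, hdis hxS _ _, hdis hxT _ _, by simp, by simp,
      by simp [hac.symm, hbc.symm]⟩)

theorem oreGraph_splitRobust_inr (hxy : G₁.Adj x y)
    (hA : (A ∩ G₂.neighborSet z).Nonempty) (hA' : (G₂.neighborSet z \ A).Nonempty)
    (h₁' : IsKFour G₁ ∨ DiamondOrTwoAvoiding G₁)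
    (h₂' : IsKFour G₂ ∨ DiamondOrTwoAvoiding G₂) (w : {v : V₂ // v ≠ z}) :
    SplitRobust (oreGraph G₁ x y G₂ z A) (.inr w) := by
  rcases h₁' with h₁ | h₁
  · exact Or.inl (h₁.diamondAvoiding_oreGraph hxy.ne w)
  obtain h | hx := h₁ x
  · exact Or.inl (h.oreGraph_left_inr hxy w)
  obtain h | hy := h₁ y
  · rw [oreGraph_swap]
    exact Or.inl (h.oreGraph_left_inr hxy.symm w)
  rcases h₂' with h₂ | h₂
  · obtain ⟨a, b, c, ha, hb, hc, hab, hac, hbc, hcov, hside⟩ := h₂.exists_split hA hA'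
    rcases hside with ⟨haA, hbA, -⟩ | ⟨haA, hbA, -⟩
    · exact oreGraph_splitRobust_inr_of_isKFour h₂ hx ha hb hc hab hac hbc hcov haA hbA w
    · rw [oreGraph_swap]
      exact oreGraph_splitRobust_inr_of_isKFour h₂ hy ha hb hc hab hac hbc hcov haA hbA w
  obtain ⟨S, T, hS, hT, hd, hxS, hxT⟩ := hx
  have of_cycle {U : Set V₂} (hU : IsTriOrQuad G₂ U) (hz : z ∉ U) (hw : w.1 ∉ U) :
      SplitRobust (oreGraph G₁ x y G₂ z A) (.inr w) :=
    Or.inr (Or.inl ⟨_, _, _, hS.oreGraph_left hxS, hT.oreGraph_left hxT, hU.oreGraph_right hz,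
      disjoint_inl_image hd, disjoint_inl_image_inr_image _ _, disjoint_inl_image_inr_image _ _,
      by simp, by simp, by simpa using hw⟩)
  have of_spine {a b c d : V₂} (hD : ExactDiamond G₂ a b c d) (hb : b ≠ z) (hc : c ≠ z)
      (hd' : d ≠ z) (hw : w.1 = a) : SplitRobust (oreGraph G₁ x y G₂ z A) (.inr w) := by
    have hset : ({Sum.inr ⟨b, hb⟩, Sum.inr ⟨c, hc⟩, Sum.inr ⟨d, hd'⟩} :
        Set (V₁ ⊕ {v : V₂ // v ≠ z})) = Sum.inr '' {⟨b, hb⟩, ⟨c, hc⟩, ⟨d, hd'⟩} := by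
      simp [Set.image_insert_eq]
    refine Or.inr (Or.inr ⟨_, _, .inr ⟨b, hb⟩, .inr ⟨c, hc⟩, .inr ⟨d, hd'⟩, hS.oreGraph_left hxS,
      hT.oreGraph_left hxT, disjoint_inl_image hd, by simp, by simp, ?_, ?_,
      by simpa using hD.1, ?_, ?_, ?_, ?_, ?_⟩)
    · rw [hset]
      exact disjoint_inl_image_inr_image _ _
    · rw [hset]
      exact disjoint_inl_image_inr_image _ _
    all_goals
      rw [oreGraph_adj_inr_inr]
      first
      | rw [hw, hD.2.1]
        simp
      | rw [hD.2.2]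
        simp
  obtain ⟨a, b, c, d, hD, ha, hb, hc, hd'⟩ | ⟨U, U', hU, hU', hdU, hzU, hzU'⟩ := h₂ z
  · by_cases hwa : w.1 = a
    · exact of_spine hD hb hc hd' hwa
    by_cases hwb : w.1 = b
    · exact of_spine hD.swap_spine ha hc hd' hwb
    by_cases hwc : w.1 = c
    · refine of_cycle (IsTriOrQuad.of_exactDiamond hD.swap_tips)
        (by simp [ha.symm, hb.symm, hd'.symm]) ?_
      have := hD.1
      simp only [Set.mem_insert_iff, Set.mem_singleton_iff]
      grind
    · exact of_cycle (IsTriOrQuad.of_exactDiamond hD)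
        (by simp [ha.symm, hb.symm, hc.symm]) (by simp [hwa, hwb, hwc])
  · by_cases hw : w.1 ∈ U
    · exact of_cycle hU' hzU' (Set.disjoint_left.1 hdU hw)
    · exact of_cycle hU hzU hw

theorem oreGraph_splitRobust (hxy : G₁.Adj x y)
    (hA : (A ∩ G₂.neighborSet z).Nonempty) (hA' : (G₂.neighborSet z \ A).Nonempty)
    (h₁ : OneAvoidingAll G₁) (h₁' : IsKFour G₁ ∨ DiamondOrTwoAvoiding G₁)
    (h₂' : IsKFour G₂ ∨ DiamondOrTwoAvoiding G₂) (hne : ¬ (IsKFour G₁ ∧ IsKFour G₂))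
    (v : V₁ ⊕ {v : V₂ // v ≠ z}) : SplitRobust (oreGraph G₁ x y G₂ z A) v := by
  rcases v with p | w
  · by_cases hpx : p = x
    · subst hpx
      exact oreGraph_splitRobust_root hxy hA hA' h₁ h₁' h₂' hne
    by_cases hpy : p = y
    · subst hpy
      rw [oreGraph_swap]
      refine oreGraph_splitRobust_root hxy.symm ?_ ?_ h₁ h₁' h₂' hne
      · rwa [Set.inter_comm, ← Set.sdiff_eq]
      · rwa [Set.sdiff_compl, Set.inter_comm]
    exact oreGraph_splitRobust_inl hxy hA hA' h₁' h₂' hpx hpy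
  · exact oreGraph_splitRobust_inr hxy hA hA' h₁' h₂' w

end Ore

/-! ### The 4-Ore graphs -/

theorem isKFour_top : IsKFour (⊤ : SimpleGraph (Fin 4)) := by
  refine ⟨fun a b => SimpleGraph.top_adj a b, ?_⟩
  decide

theorem IsKFour.card_le {V : Type*} {G : SimpleGraph V} (h : IsKFour G) : Nat.card V ≤ 4 := by
  classical
  rcases subsingleton_or_nontrivial V with _ | _
  · exact (Finite.card_le_one_iff_subsingleton.2 ‹_›).trans (by norm_num)
  obtain ⟨x, y, hxy⟩ := exists_pair_ne V
  obtain ⟨a, b, -, -, -, -, -, hcov⟩ := h.2 x y hxy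
  have huniv : (Set.univ : Set V) = (({x, y, a, b} : Finset V) : Set V) := by
    ext u
    simpa using hcov u
  rw [← Set.ncard_univ, huniv, Set.ncard_coe_finset]
  exact Finset.card_le_four

theorem FourOreAux.avoiding {n : ℕ} {G : SimpleGraph (Fin n)} (h : FourOreAux G) :
    OneAvoidingAll G ∧ (IsKFour G ∨ DiamondOrTwoAvoiding G) := by
  induction h with
  | k4 =>
    refine ⟨fun v => ?_, Or.inl isKFour_top⟩
    obtain ⟨a, b, c, ha, hb, hc, hab, hbc, hca⟩ : ∃ a b c : Fin 4,
      v ≠ a ∧ v ≠ b ∧ v ≠ c ∧ a ≠ b ∧ b ≠ c ∧ c ≠ a := by revert v; decide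
    exact ⟨{a, b, c}, Or.inl ⟨a, b, c, hab, hbc, hca, rfl⟩, by simp [ha, hb, hc]⟩
  | ore _ _ hcomp ih₁ ih₂ =>
    obtain ⟨x, y, z, A, hxy, hA, hA', ⟨e⟩⟩ := hcomp
    exact ⟨(oreGraph_oneAvoidingAll ih₁.1 ih₂.1).map_iso e.symm,
      Or.inr ((oreGraph_diamondOrTwoAvoiding hxy hA hA' ih₁.1 ih₁.2 ih₂.2).map_iso e.symm)⟩

theorem IsFourOre.finite {V : Type*} {H : SimpleGraph V} (h : IsFourOre H) : Finite V := by
  obtain ⟨n, G, -, ⟨e⟩⟩ := h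
  exact Finite.of_equiv _ e.toEquiv.symm

theorem IsFourOre.splitRobust {V : Type*} {H : SimpleGraph V} (h : IsFourOre H)
    (hcard : 8 ≤ Nat.card V) (v : V) : SplitRobust H v := by
  obtain ⟨n, G, hG, ⟨e⟩⟩ := h
  have hn : Nat.card V = n := by simpa using Nat.card_congr e.toEquiv
  cases hG with
  | k4 => omega
  | ore hG₁ hG₂ hcomp =>
    obtain ⟨x, y, z, A, hxy, hA, hA', ⟨e'⟩⟩ := hcomp
    rename_i n₁ n₂ G₁ G₂
    have hne : ¬ (IsKFour G₁ ∧ IsKFour G₂) := fun ⟨h₁, h₂⟩ => by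
      have hn₁ := h₁.card_le
      have hn₂ := h₂.card_le
      have hsub : Nat.card {v : Fin n₂ // v ≠ z} = n₂ - 1 := by simp
      have hsum := Nat.card_congr e'.toEquiv
      rw [Nat.card_sum, hsub] at hsum
      simp only [Nat.card_eq_fintype_card, Fintype.card_fin] at hn₁ hn₂ hsum
      omega
    have := (oreGraph_splitRobust hxy hA hA' hG₁.avoiding.1 hG₁.avoiding.2 hG₂.avoiding.2 hne
      ((e.trans e') v)).map_iso (e.trans e').symm
    simpa using this

/-! ### Splitting a vertex -/

section Split

variable {V : Type*} {H : SimpleGraph V} {v : V} {A : Set V}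

theorem splitGraph_adj_inl_inl {a b : {u : V // u ≠ v}} :
    (splitGraph H v A).Adj (.inl a) (.inl b) ↔ H.Adj a b := by
  simp only [splitGraph, SimpleGraph.fromRel_adj, ne_eq, Sum.inl.injEq, H.adj_comm b a, or_self,
    and_iff_right_iff_imp]
  rintro h rfl
  exact h.ne rfl

theorem splitGraph_adj_inl_inr {a : {u : V // u ≠ v}} {i : Fin 2} :
    (splitGraph H v A).Adj (.inl a) (.inr i) ↔
      H.Adj v a ∧ ((i = 0 ∧ a.1 ∈ A) ∨ (i = 1 ∧ a.1 ∉ A)) := by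
  simp [splitGraph, SimpleGraph.fromRel_adj]

theorem IsTriOrQuad.splitGraph {S : Set V} (h : IsTriOrQuad H S) (hv : v ∉ S) :
    IsTriOrQuad (splitGraph H v A) (Sum.inl '' (Subtype.val ⁻¹' S)) :=
  (h.comap_val hv).map Sum.inl_injective.injOn fun _ _ _ _ hab => splitGraph_adj_inl_inl.2 hab

theorem DiamondAvoiding.exists_isDiamond_splitGraph (h : DiamondAvoiding H v) :
    ∃ a b c d : {u : V // u ≠ v} ⊕ Fin 2, IsDiamond (splitGraph H v A) a b c d ∧
      (∀ i : Fin 2, a ≠ Sum.inr i) ∧ (∀ i : Fin 2, b ≠ Sum.inr i) := by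
  obtain ⟨a, b, c, d, ⟨hcd, hna, hnb⟩, ha, hb, hc, hd⟩ := h
  have hab := (hna b).2 (by simp)
  have hac := (hna c).2 (by simp)
  have had := (hna d).2 (by simp)
  have hbc := (hnb c).2 (by simp)
  have hbd := (hnb d).2 (by simp)
  have hva : ¬ H.Adj v a := fun h => by
    rcases (hna v).1 h.symm with h | h | h <;> exact absurd h.symm ‹_›
  have hvb : ¬ H.Adj v b := fun h => by
    rcases (hnb v).1 h.symm with h | h | h <;> exact absurd h.symm ‹_›
  refine ⟨.inl ⟨a, ha⟩, .inl ⟨b, hb⟩, .inl ⟨c, hc⟩, .inl ⟨d, hd⟩, ⟨by simpa using hab.ne,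
    by simpa using hac.ne, by simpa using had.ne, by simpa using hbc.ne, by simpa using hbd.ne,
    by simpa using hcd, splitGraph_adj_inl_inl.2 hab, splitGraph_adj_inl_inl.2 hac,
    splitGraph_adj_inl_inl.2 had, splitGraph_adj_inl_inl.2 hbc, splitGraph_adj_inl_inl.2 hbd,
    Set.ncard_eq_three.2 ⟨.inl ⟨b, hb⟩, .inl ⟨c, hc⟩, .inl ⟨d, hd⟩, by simpa using hbc.ne,
      by simpa using hbd.ne, by simpa using hcd, ?_⟩,
    Set.ncard_eq_three.2 ⟨.inl ⟨a, ha⟩, .inl ⟨c, hc⟩, .inl ⟨d, hd⟩, by simpa using hac.ne,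
      by simpa using had.ne, by simpa using hcd, ?_⟩⟩, by simp, by simp⟩
  all_goals
    ext (u | u) <;> simp [splitGraph_adj_inl_inl, splitGraph_adj_inl_inr, Subtype.ext_iff, *]

/-- Splitting a degree-three vertex of a diamond leaves a short cycle. -/
theorem exists_isTriOrQuad_splitGraph {u c d : V} (hcd : c ≠ d) (hvu : H.Adj v u)
    (hvc : H.Adj v c) (hvd : H.Adj v d) (huc : H.Adj u c) (hud : H.Adj u d) :
    ∃ U, IsTriOrQuad (splitGraph H v A) U ∧
      ∀ w : {w : V // w ≠ v}, .inl w ∈ U → w.1 ∈ ({u, c, d} : Set V) := by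
  have tri {p q : V} {i : Fin 2} (hp : H.Adj v p) (hq : H.Adj v q) (hpq : H.Adj p q)
      (hip : (i = 0 ∧ p ∈ A) ∨ (i = 1 ∧ p ∉ A)) (hiq : (i = 0 ∧ q ∈ A) ∨ (i = 1 ∧ q ∉ A)) :
      IsTriOrQuad (_root_.splitGraph H v A) {.inl ⟨p, hp.ne'⟩, .inl ⟨q, hq.ne'⟩, .inr i} :=
    Or.inl ⟨_, _, _, splitGraph_adj_inl_inl.2 hpq, splitGraph_adj_inl_inr.2 ⟨hq, hiq⟩,
      (splitGraph_adj_inl_inr.2 ⟨hp, hip⟩).symm, rfl⟩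
  have quad {i : Fin 2} (hic : (i = 0 ∧ c ∈ A) ∨ (i = 1 ∧ c ∉ A))
      (hid : (i = 0 ∧ d ∈ A) ∨ (i = 1 ∧ d ∉ A)) : IsTriOrQuad (_root_.splitGraph H v A)
        {.inl ⟨u, hvu.ne'⟩, .inl ⟨c, hvc.ne'⟩, .inr i, .inl ⟨d, hvd.ne'⟩} :=
    Or.inr ⟨_, _, _, _, by simp, by simpa using hcd, splitGraph_adj_inl_inl.2 huc,
      splitGraph_adj_inl_inr.2 ⟨hvc, hic⟩, (splitGraph_adj_inl_inr.2 ⟨hvd, hid⟩).symm,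
      splitGraph_adj_inl_inl.2 hud.symm, rfl⟩
  by_cases hu : u ∈ A <;> by_cases hc : c ∈ A <;> by_cases hd : d ∈ A <;>
    first
    | exact ⟨_, tri (i := 0) hvu hvc huc (by tauto) (by tauto), by simp +contextual [or_imp]⟩
    | exact ⟨_, tri (i := 1) hvu hvc huc (by tauto) (by tauto), by simp +contextual [or_imp]⟩
    | exact ⟨_, tri (i := 0) hvu hvd hud (by tauto) (by tauto), by simp +contextual [or_imp]⟩
    | exact ⟨_, tri (i := 1) hvu hvd hud (by tauto) (by tauto), by simp +contextual [or_imp]⟩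
    | exact ⟨_, quad (i := 0) (by tauto) (by tauto), by simp +contextual [or_imp]⟩
    | exact ⟨_, quad (i := 1) (by tauto) (by tauto), by simp +contextual [or_imp]⟩

theorem SplitRobust.splitGraph [Finite V] (h : SplitRobust H v) :
    (∃ a b c d : {u : V // u ≠ v} ⊕ Fin 2, IsDiamond (splitGraph H v A) a b c d ∧
      (∀ i : Fin 2, a ≠ Sum.inr i) ∧ (∀ i : Fin 2, b ≠ Sum.inr i)) ∨
    3 ≤ maxTri (splitGraph H v A) := by
  have hdis {S T : Set V} (h : Disjoint S T) :
      Disjoint (Sum.inl '' (Subtype.val ⁻¹' S) : Set ({u : V // u ≠ v} ⊕ Fin 2))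
        (Sum.inl '' (Subtype.val ⁻¹' T)) :=
    disjoint_inl_image (h.preimage _)
  rcases h with h | ⟨S, T, U, hS, hT, hU, hST, hSU, hTU, hvS, hvT, hvU⟩ |
    ⟨S, T, u, c, d, hS, hT, hST, hvS, hvT, hSd, hTd, hcd, hvu, hvc, hvd, huc, hud⟩
  · exact Or.inl h.exists_isDiamond_splitGraph
  · exact Or.inr (three_le_maxTri (hS.splitGraph hvS) (hT.splitGraph hvT) (hU.splitGraph hvU)
      (hdis hST) (hdis hSU) (hdis hTU))
  · obtain ⟨U, hU, hsub⟩ := exists_isTriOrQuad_splitGraph (A := A) hcd hvu hvc hvd huc hud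
    have hdis' {S : Set V} (hSd : Disjoint S {u, c, d}) :
        Disjoint (Sum.inl '' (Subtype.val ⁻¹' S)) U := by
      rw [Set.disjoint_left]
      rintro _ ⟨w, hw, rfl⟩ hwU
      exact Set.disjoint_left.1 hSd hw (hsub w hwU)
    exact Or.inr (three_le_maxTri (hS.splitGraph hvS) (hT.splitGraph hvT) hU (hdis hST)
      (hdis' hSd) (hdis' hTd))

end Split

/-- If `H` is 4-Ore with `T(H) = 3` and `H'` is obtained from `H` by splitting a vertex `v`
into two vertices of positive degree, then either `H'` has a diamond in which neither of the
two new vertices is a degree-three vertex of the diamond, or `T(H') ≥ 3`. -/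
theorem fourOre_T3_split {V : Type*} (H : SimpleGraph V) (hH : IsFourOre H)
    (hT : maxTri H = 3) (v : V) (A : Set V)
    (h₁ : (A ∩ H.neighborSet v).Nonempty) (h₂ : (H.neighborSet v \ A).Nonempty) :
    (∃ a b c d : {u : V // u ≠ v} ⊕ Fin 2, IsDiamond (splitGraph H v A) a b c d ∧
      (∀ i : Fin 2, a ≠ Sum.inr i) ∧ (∀ i : Fin 2, b ≠ Sum.inr i)) ∨
    3 ≤ maxTri (splitGraph H v A) := by
  have := hH.finite
  have hcard := three_mul_maxTri_le H
  exact (hH.splitRobust (by omega) v).splitGraph
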